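/- Let p be an odd prime with p | D = P² − 4Q and p ∤ Q, for a nondegenerate Lucas sequence U(P,Q). Then the p-adic valuation of the Möbius dual M^U_n = ∏_{d|n} U_d^{μ(n/d)} satisfies: v_p(M^U_n) = v_p(U_p) if n = p; v_p(M^U_n) = 1 if n = p^k with k > 1; and v_p(M^U_n) = 0 otherwise. -/

import Mathlib

open ArithmeticFunction Finset

def lucasU (P Q : ℤ) : ℕ → ℤ
  | 0 => 0
  | 1 => 1
  | (n + 2) => P * lucasU P Q (n + 1) - Q * lucasU P Q n

/-- Modulo the discriminant, `U_{n+1} ≡ (n + 1) (P / 2) ^ n`. -/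
lemma disc_dvd_two_pow_mul_lucasU_sub (P Q : ℤ) (n : ℕ) :
    P ^ 2 - 4 * Q ∣ 2 ^ n * lucasU P Q (n + 1) - (n + 1) * P ^ n := by
  induction n using Nat.twoStepInduction with
  | zero => simp [lucasU]
  | one => simp [lucasU]
  | more n ih₀ ih₁ =>
    obtain ⟨a, ha⟩ := ih₀
    obtain ⟨b, hb⟩ := ih₁
    refine ⟨2 * P * b - 4 * Q * a + (n + 1) * P ^ n, ?_⟩
    rw [lucasU]
    push_cast at hb ⊢
    linear_combination 2 * P * hb - 4 * Q * ha

lemma lucasU_sq_sub (P Q : ℤ) (n : ℕ) :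
    lucasU P Q (n + 1) ^ 2 - P * lucasU P Q (n + 1) * lucasU P Q n + Q * lucasU P Q n ^ 2
      = Q ^ n := by
  induction n with
  | zero => simp [lucasU]
  | succ n ih =>
    rw [lucasU]
    linear_combination Q * ih

lemma lucasU_add_succ (P Q : ℤ) (m n : ℕ) :
    lucasU P Q (m + n + 1) =
      lucasU P Q (m + 1) * lucasU P Q (n + 1) - Q * lucasU P Q m * lucasU P Q n := by
  induction m using Nat.twoStepInduction with
  | zero => simp [lucasU]
  | one =>
    rw [show 1 + n + 1 = n + 2 by ring]
    simp [lucasU]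
  | more m ih₀ ih₁ =>
    rw [show m + 2 + n + 1 = m + n + 1 + 2 by ring, lucasU,
      show m + n + 1 + 1 = m + 1 + n + 1 by ring, ih₀, ih₁]
    simp only [lucasU]
    ring

/-- The companion Lucas sequence `V`, expressed through `U`. -/
def lucasV (P Q : ℤ) (n : ℕ) : ℤ := 2 * lucasU P Q (n + 1) - P * lucasU P Q n

lemma lucasV_sq_sub (P Q : ℤ) (n : ℕ) :
    lucasV P Q n ^ 2 - 4 * Q ^ n = (P ^ 2 - 4 * Q) * lucasU P Q n ^ 2 := by
  rw [lucasV]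
  linear_combination 4 * lucasU_sq_sub P Q n

lemma lucasU_add_add (P Q : ℤ) (a n : ℕ) :
    lucasU P Q (a + n + n) = lucasV P Q n * lucasU P Q (a + n) - Q ^ n * lucasU P Q a := by
  induction a using Nat.twoStepInduction with
  | zero =>
    rcases n with _ | n
    · simp [lucasU]
    · rw [show 0 + (n + 1) + (n + 1) = (n + 1) + n + 1 by ring, lucasU_add_succ, lucasV]
      simp only [zero_add, lucasU]
      ring
  | one =>
    rw [show 1 + n + n = n + n + 1 by ring, lucasU_add_succ, lucasV, add_comm 1 n]
    simp only [lucasU]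
    linear_combination -lucasU_sq_sub P Q n
  | more a ih₀ ih₁ =>
    rw [show a + 2 + n + n = a + n + n + 2 by ring, show a + 2 + n = a + n + 2 by ring]
    simp only [lucasU]
    rw [show a + n + n + 1 = a + 1 + n + n by ring, ih₀, ih₁,
      show a + 1 + n = a + n + 1 by ring]
    ring

lemma lucasU_mul (P Q : ℤ) (m n : ℕ) :
    lucasU P Q (m * n) = lucasU P Q n * lucasU (lucasV P Q n) (Q ^ n) m := by
  induction m using Nat.twoStepInduction with
  | zero => simp [lucasU]
  | one => simp [lucasU]
  | more m ih₀ ih₁ =>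
    rw [show (m + 2) * n = m * n + n + n by ring, lucasU_add_add,
      show m * n + n = (m + 1) * n by ring, ih₀, ih₁, lucasU]
    ring

section Valuation

variable {p : ℕ} {P Q : ℤ}

lemma not_dvd_of_dvd_disc (hp : p.Prime) (hodd : Odd p) (hpQ : ¬ (p : ℤ) ∣ Q)
    (hpD : (p : ℤ) ∣ P ^ 2 - 4 * Q) : ¬ (p : ℤ) ∣ P ∧ ¬ (p : ℤ) ∣ 2 := by
  have hp' : Prime (p : ℤ) := Nat.prime_iff_prime_int.mp hp
  have h2 : ¬ (p : ℤ) ∣ 2 := by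
    intro h
    have h' : p ∣ 2 := by exact_mod_cast h
    rw [Nat.prime_dvd_prime_iff_eq hp Nat.prime_two] at h'
    subst h'
    exact absurd hodd (by decide)
  refine ⟨fun h => ?_, h2⟩
  have h4 : (p : ℤ) ∣ 2 * (2 * Q) := by
    have := dvd_sub (h.mul_left P) hpD
    rwa [show P * P - (P ^ 2 - 4 * Q) = 2 * (2 * Q) by ring] at this
  rcases hp'.dvd_or_dvd h4 with h | h
  · exact h2 h
  · exact (hp'.dvd_or_dvd h).elim h2 hpQ

lemma dvd_lucasU_iff (hp : p.Prime) (hodd : Odd p) (hpQ : ¬ (p : ℤ) ∣ Q)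
    (hpD : (p : ℤ) ∣ P ^ 2 - 4 * Q) (n : ℕ) : (p : ℤ) ∣ lucasU P Q n ↔ p ∣ n := by
  have hp' : Prime (p : ℤ) := Nat.prime_iff_prime_int.mp hp
  obtain ⟨hP, h2⟩ := not_dvd_of_dvd_disc hp hodd hpQ hpD
  rcases n with _ | n
  · simp [lucasU]
  have h := dvd_sub_comm.mp (hpD.trans (disc_dvd_two_pow_mul_lucasU_sub P Q n))
  have hn : ((n : ℤ) + 1) = ((n + 1 : ℕ) : ℤ) := by push_cast; rfl
  constructor
  · intro hU
    have := (dvd_iff_dvd_of_dvd_sub h).mpr (hU.mul_left _)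
    rcases hp'.dvd_or_dvd this with h | h
    · rw [hn] at h
      exact_mod_cast h
    · exact absurd (hp'.dvd_of_dvd_pow h) hP
  · intro hU
    have hU' : (p : ℤ) ∣ (n : ℤ) + 1 := by
      rw [hn]
      exact_mod_cast hU
    have := (dvd_iff_dvd_of_dvd_sub h).mp (hU'.mul_right _)
    exact (hp'.dvd_or_dvd this).resolve_left fun h => h2 (hp'.dvd_of_dvd_pow h)

lemma padicValInt_lucasU_self (hp : p.Prime) (hodd : Odd p) (hpQ : ¬ (p : ℤ) ∣ Q)
    (hpD : (p : ℤ) ^ 2 ∣ P ^ 2 - 4 * Q) : padicValInt p (lucasU P Q p) = 1 := by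
  have : Fact p.Prime := ⟨hp⟩
  have hp' : Prime (p : ℤ) := Nat.prime_iff_prime_int.mp hp
  have hpD' : (p : ℤ) ∣ P ^ 2 - 4 * Q := (dvd_pow_self _ two_ne_zero).trans hpD
  obtain ⟨hP, -⟩ := not_dvd_of_dvd_disc hp hodd hpQ hpD'
  obtain ⟨u, hu⟩ := (dvd_lucasU_iff hp hodd hpQ hpD' p).mpr dvd_rfl
  obtain ⟨t, ht⟩ := hpD.trans (disc_dvd_two_pow_mul_lucasU_sub P Q (p - 1))
  rw [Nat.sub_add_cancel hp.one_le, hu, Nat.cast_pred hp.pos, sub_add_cancel] at ht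
  have hmul : 2 ^ (p - 1) * u - P ^ (p - 1) = p * t :=
    mul_left_cancel₀ hp'.ne_zero (by linear_combination ht)
  have hndvd : ¬ (p : ℤ) ∣ u := by
    intro h
    refine hP (hp'.dvd_of_dvd_pow (n := p - 1) ?_)
    rw [show P ^ (p - 1) = 2 ^ (p - 1) * u - p * t by linear_combination -hmul]
    exact dvd_sub (h.mul_left _) (dvd_mul_right _ _)
  have hu0 : u ≠ 0 := by
    rintro rfl
    exact hndvd (dvd_zero _)
  rw [hu, padicValInt.mul hp'.ne_zero hu0, padicValInt.self hp.one_lt,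
    padicValInt.eq_zero_of_not_dvd hndvd]

lemma padicValInt_lucasU_mul (hp : p.Prime) (hnd : ∀ n : ℕ, 1 ≤ n → lucasU P Q n ≠ 0)
    {m n : ℕ} (hm : 1 ≤ m) (hn : 1 ≤ n) :
    padicValInt p (lucasU P Q (m * n)) =
      padicValInt p (lucasU P Q n) + padicValInt p (lucasU (lucasV P Q n) (Q ^ n) m) := by
  have : Fact p.Prime := ⟨hp⟩
  have h := hnd (m * n) (Nat.mul_pos hm hn)
  rw [lucasU_mul] at h ⊢
  exact padicValInt.mul (left_ne_zero_of_mul h) (right_ne_zero_of_mul h)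

lemma padicValInt_lucasU_mul_of_not_dvd (hp : p.Prime) (hodd : Odd p) (hpQ : ¬ (p : ℤ) ∣ Q)
    (hpD : (p : ℤ) ∣ P ^ 2 - 4 * Q) (hnd : ∀ n : ℕ, 1 ≤ n → lucasU P Q n ≠ 0)
    {m n : ℕ} (hm : ¬ p ∣ m) (hn : 1 ≤ n) :
    padicValInt p (lucasU P Q (m * n)) = padicValInt p (lucasU P Q n) := by
  have hm1 : 1 ≤ m := Nat.one_le_iff_ne_zero.mpr fun h => hm (h ▸ dvd_zero p)
  have hp' : Prime (p : ℤ) := Nat.prime_iff_prime_int.mp hp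
  rw [padicValInt_lucasU_mul hp hnd hm1 hn, Nat.add_eq_left]
  apply padicValInt.eq_zero_of_not_dvd
  rwa [dvd_lucasU_iff hp hodd fun h => hpQ (hp'.dvd_of_dvd_pow h)]
  rw [lucasV_sq_sub]
  exact hpD.mul_right _

lemma padicValInt_lucasU_prime_mul (hp : p.Prime) (hodd : Odd p) (hpQ : ¬ (p : ℤ) ∣ Q)
    (hpD : (p : ℤ) ∣ P ^ 2 - 4 * Q) (hnd : ∀ n : ℕ, 1 ≤ n → lucasU P Q n ≠ 0)
    {n : ℕ} (hpn : p ∣ n) (hn : 1 ≤ n) :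
    padicValInt p (lucasU P Q (p * n)) = padicValInt p (lucasU P Q n) + 1 := by
  have hp' : Prime (p : ℤ) := Nat.prime_iff_prime_int.mp hp
  rw [padicValInt_lucasU_mul hp hnd hp.one_le hn,
    padicValInt_lucasU_self hp hodd fun h => hpQ (hp'.dvd_of_dvd_pow h)]
  rw [lucasV_sq_sub]
  exact (pow_dvd_pow_of_dvd ((dvd_lucasU_iff hp hodd hpQ hpD n).mpr hpn) 2).mul_left _

open Classical in
/-- The function supported on the powers of `p` which is `c` at `p` and `1` at higher powers. -/
noncomputable def primePowWeight (p : ℕ) (c : ℤ) (n : ℕ) : ℤ :=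
  if n = p then c else if ∃ k : ℕ, 1 < k ∧ n = p ^ k then 1 else 0

lemma primePowWeight_eq_zero {c : ℤ} {n : ℕ} (h : ∀ k, 1 ≤ k → n ≠ p ^ k) :
    primePowWeight p c n = 0 := by
  rw [primePowWeight, if_neg (by simpa using h 1 le_rfl), if_neg]
  rintro ⟨k, hk, rfl⟩
  exact h k hk.le rfl

lemma primePowWeight_pow (hp : p.Prime) (c : ℤ) {k : ℕ} (hk : 1 < k) :
    primePowWeight p c (p ^ k) = 1 := by
  have hne : p ^ k ≠ p := fun h => hk.ne' (Nat.pow_right_injective hp.two_le (by simpa using h))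
  rw [primePowWeight, if_neg hne, if_pos ⟨k, hk, rfl⟩]

lemma sum_primePowWeight (hp : p.Prime) (hodd : Odd p) (hpQ : ¬ (p : ℤ) ∣ Q)
    (hpD : (p : ℤ) ∣ P ^ 2 - 4 * Q) (hnd : ∀ n : ℕ, 1 ≤ n → lucasU P Q n ≠ 0) (n : ℕ) (hn : 0 < n) :
    ∑ d ∈ n.divisors, primePowWeight p (padicValInt p (lucasU P Q p)) d =
      padicValInt p (lucasU P Q n) := by
  obtain ⟨k, m, hm, rfl⟩ := Nat.exists_eq_pow_mul_and_not_dvd hn.ne' p hp.ne_one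
  rw [mul_comm (p ^ k) m, padicValInt_lucasU_mul_of_not_dvd hp hodd hpQ hpD hnd hm
    (Nat.pow_pos hp.pos)]
  have hsub : (p ^ k).divisors ⊆ (m * p ^ k).divisors :=
    Nat.divisors_subset_of_dvd (by rwa [mul_comm, ← Nat.pos_iff_ne_zero]) (dvd_mul_left _ _)
  rw [← Finset.sum_subset hsub, Nat.sum_divisors_prime_pow hp]
  · rw [Finset.sum_range_succ', primePowWeight_eq_zero (n := p ^ 0), add_zero]
    · clear hsub hn
      induction k with
      | zero => simp [lucasU]
      | succ k ih =>
        rw [Finset.sum_range_succ, ih]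
        rcases k with _ | k
        · simp [lucasU, primePowWeight]
        · rw [primePowWeight_pow hp _ (by omega), pow_succ' p (k + 1),
            padicValInt_lucasU_prime_mul hp hodd hpQ hpD hnd (dvd_pow_self p k.succ_ne_zero)
              (Nat.pow_pos hp.pos)]
          push_cast
          rfl
    · intro i hi h
      exact (Nat.one_lt_pow (Nat.one_le_iff_ne_zero.mp hi) hp.one_lt).ne (by simpa using h)
  · intro d hd hd'
    refine primePowWeight_eq_zero fun i _ hdi => hd' ?_
    subst hdi
    have hdvd := (Nat.mem_divisors.mp hd).1
    have hcop : Nat.Coprime (p ^ i) m := ((Nat.Prime.coprime_iff_not_dvd hp).mpr hm).pow_left i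
    exact Nat.mem_divisors.mpr ⟨hcop.dvd_of_dvd_mul_left hdvd, (Nat.pow_pos hp.pos).ne'⟩

lemma sum_moebius_mul_padicValInt_lucasU (hp : p.Prime) (hodd : Odd p) (hpQ : ¬ (p : ℤ) ∣ Q)
    (hpD : (p : ℤ) ∣ P ^ 2 - 4 * Q) (hnd : ∀ n : ℕ, 1 ≤ n → lucasU P Q n ≠ 0)
    (n : ℕ) (hn : 1 ≤ n) :
    ∑ d ∈ n.divisors, moebius (n / d) * (padicValInt p (lucasU P Q d) : ℤ) =
      primePowWeight p (padicValInt p (lucasU P Q p)) n := by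
  have h := sum_eq_iff_sum_mul_moebius_eq.mp (sum_primePowWeight hp hodd hpQ hpD hnd) n hn
  rw [← h]
  exact (Nat.sum_divisorsAntidiagonal'
    fun x y => moebius x * (padicValInt p (lucasU P Q y) : ℤ)).symm

end Valuation

theorem vp_moebius_dual_of_dvd_disc (p : ℕ) (hp : p.Prime) (hodd : Odd p)
    (P Q : ℤ) (hP : P ≠ 0) (hQ : Q ≠ 0)
    (hpQ : ¬ (p : ℤ) ∣ Q) (hpD : (p : ℤ) ∣ (P ^ 2 - 4 * Q))
    (hnd : ∀ n : ℕ, 1 ≤ n → lucasU P Q n ≠ 0) :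
    ∀ n : ℕ, 1 ≤ n →
      (n = p →
        ∑ d ∈ n.divisors, moebius (n / d) * (padicValInt p (lucasU P Q d) : ℤ) =
          (padicValInt p (lucasU P Q p) : ℤ)) ∧
      ((∃ k : ℕ, 1 < k ∧ n = p ^ k) →
        ∑ d ∈ n.divisors, moebius (n / d) * (padicValInt p (lucasU P Q d) : ℤ) = 1) ∧
      ((n ≠ p ∧ ¬ ∃ k : ℕ, 1 < k ∧ n = p ^ k) →
        ∑ d ∈ n.divisors, moebius (n / d) * (padicValInt p (lucasU P Q d) : ℤ) = 0) := by
  intro n hn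
  rw [sum_moebius_mul_padicValInt_lucasU hp hodd hpQ hpD hnd n hn]
  refine ⟨fun h => ?_, fun h => ?_, fun h => ?_⟩
  · simp [primePowWeight, h]
  · obtain ⟨k, hk, rfl⟩ := h
    exact primePowWeight_pow hp _ hk
  · rw [primePowWeight, if_neg h.1, if_neg h.2]
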